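/- arXiv:1709.02880 — 2 statements merged into one kernel-verified Lean document; each statement's English description precedes it below -/
import Mathlib

section
/- For every n ≥ 2 the following four sets coincide: the convex hull conv(O(n)), the lamination convex hull O(n)^{lc}, the set {A ∈ ℝ^{n×n} : σ_n(A) ≤ 1}, and the n-th lamination step R_n(O(n)). In particular the interior of conv(O(n)) equals {A ∈ ℝ^{n×n} : σ_n(A) < 1}. -/
noncomputable section
open MeasureTheory Set ENNReal Matrix

abbrev Euc (n : ℕ) := EuclideanSpace ℝ (Fin n)
abbrev Mat (n : ℕ) := Matrix (Fin n) (Fin n) ℝ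

/-- The continuous linear map on Euclidean space induced by a matrix. -/
def matCLM {n : ℕ} (A : Mat n) : Euc n →L[ℝ] Euc n :=
  LinearMap.toContinuousLinearMap (Matrix.toEuclideanLin A)

/-- The operator norm of a matrix, i.e. its largest singular value σ_n. -/
def matOpNorm {n : ℕ} (A : Mat n) : ℝ := ‖matCLM A‖

/-- The orthogonal group O(n) as a set of matrices. -/
def Oset (n : ℕ) : Set (Mat n) := {Q : Mat n | Qᵀ * Q = 1}

/-- The laminates of order at most `l`: `R_0(K) = K` and `R_l(K)` consists of the
laminates of order at most `l-1` together with all convex combinations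
`λA + (1−λ)B`, `λ ∈ (0,1)`, of rank-one connected `A, B ∈ R_{l-1}(K)`. -/
def lamSets {n : ℕ} (K : Set (Mat n)) : ℕ → Set (Mat n)
  | 0 => K
  | (l + 1) => lamSets K l ∪
      {M | ∃ A ∈ lamSets K l, ∃ B ∈ lamSets K l, ∃ t : ℝ, t ∈ Set.Ioo (0 : ℝ) 1 ∧
        (A - B).rank = 1 ∧ M = t • A + (1 - t) • B}

/-- The lamination convex hull `K^{lc} = ⋃_l R_l(K)`. -/
def lamHull {n : ℕ} (K : Set (Mat n)) : Set (Mat n) := ⋃ l, lamSets K l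

/-- The map `A ↦ matCLM A` as a linear map. -/
def matCLMLin (n : ℕ) : Mat n →ₗ[ℝ] (Euc n →L[ℝ] Euc n) :=
  ((Matrix.toEuclideanLin (𝕜 := ℝ) (m := Fin n) (n := Fin n)).trans
    LinearMap.toContinuousLinearMap).toLinearMap

lemma matCLMLin_apply {n : ℕ} (A : Mat n) : matCLMLin n A = matCLM A := rfl

lemma matOpNorm_add_le {n : ℕ} (A B : Mat n) : matOpNorm (A + B) ≤ matOpNorm A + matOpNorm B := by
  simp only [matOpNorm, ← matCLMLin_apply, map_add]
  exact norm_add_le _ _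

lemma matOpNorm_smul {n : ℕ} (c : ℝ) (A : Mat n) : matOpNorm (c • A) = |c| * matOpNorm A := by
  simp only [matOpNorm, ← matCLMLin_apply, map_smul, norm_smul, Real.norm_eq_abs]

lemma continuous_matOpNorm {n : ℕ} : Continuous (matOpNorm : Mat n → ℝ) :=
  (LinearMap.continuous_of_finiteDimensional (matCLMLin n)).norm

lemma convex_matOpNorm_le_one (n : ℕ) : Convex ℝ {A : Mat n | matOpNorm A ≤ 1} := by
  intro A hA B hB a b ha hb hab
  simp only [mem_ofPred_eq] at *
  have h := matOpNorm_add_le (a • A) (b • B)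
  rw [matOpNorm_smul, matOpNorm_smul, abs_of_nonneg ha, abs_of_nonneg hb] at h
  nlinarith

lemma matCLM_apply {n : ℕ} (A : Mat n) (x : Euc n) (i : Fin n) :
    matCLM A x i = ∑ j, A i j * x j := rfl

lemma matCLM_mul {n : ℕ} (A B : Mat n) : matCLM (A * B) = (matCLM A).comp (matCLM B) := by
  ext x : 1
  simp [matCLM, Matrix.toEuclideanLin, Matrix.toLpLin_apply, Matrix.mulVec_mulVec]

lemma matCLM_transpose_inner {n : ℕ} (A : Mat n) (x y : Euc n) :
    inner ℝ (matCLM Aᵀ x) y = inner ℝ x (matCLM A y) := by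
  simp only [PiLp.inner_apply, matCLM_apply, transpose_apply, RCLike.inner_apply, conj_trivial,
    Finset.mul_sum, Finset.sum_mul]
  rw [Finset.sum_comm]
  exact Finset.sum_congr rfl fun i _ => Finset.sum_congr rfl fun j _ => by ring

lemma Oset_subset_matOpNorm_le_one (n : ℕ) : Oset n ⊆ {A : Mat n | matOpNorm A ≤ 1} := by
  intro Q hQ
  refine ContinuousLinearMap.opNorm_le_bound _ zero_le_one fun x => le_of_eq ?_
  have h1 : matCLM (Qᵀ * Q) x = x := by
    rw [show Qᵀ * Q = 1 from hQ]
    simp [matCLM, Matrix.toEuclideanLin]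
  have h2 := matCLM_transpose_inner Q (matCLM Q x) x
  rw [matCLM_mul, ContinuousLinearMap.comp_apply] at h1
  rw [h1, real_inner_self_eq_norm_sq, real_inner_self_eq_norm_sq] at h2
  rw [one_mul]
  exact ((sq_eq_sq₀ (norm_nonneg _) (norm_nonneg _)).1 h2).symm

lemma lamSets_subset_convexHull {n : ℕ} (K : Set (Mat n)) (l : ℕ) :
    lamSets K l ⊆ convexHull ℝ K := by
  induction l with
  | zero => exact subset_convexHull ℝ K
  | succ l ih =>
    rintro M (hM | ⟨A, hA, B, hB, t, ht, -, rfl⟩)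
    · exact ih hM
    · exact convex_convexHull ℝ K (ih hA) (ih hB) ht.1.le (by linarith [ht.2]) (by ring)

lemma lamSets_mono {n : ℕ} (K : Set (Mat n)) : Monotone (lamSets K) :=
  monotone_nat_of_le_succ fun _ => subset_union_left

/-- Singular value decomposition: a linear map sends some orthonormal basis to nonnegative
multiples of another one. -/
lemma exists_orthonormalBasis_map_eq_norm_smul {n : ℕ} (T : Euc n →ₗ[ℝ] Euc n) :
    ∃ u v : OrthonormalBasis (Fin n) ℝ (Euc n), ∀ i, T (v i) = ‖T (v i)‖ • u i := by
  have hsymm : (LinearMap.adjoint T * T).IsSymmetric := LinearMap.isSymmetric_adjoint_mul_self T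
  have hfin : Module.finrank ℝ (Euc n) = n := by simp
  let v := hsymm.eigenvectorBasis hfin
  have horth : ∀ i j, i ≠ j → inner ℝ (T (v i)) (T (v j)) = 0 := by
    intro i j hij
    rw [← LinearMap.adjoint_inner_left]
    change inner ℝ ((LinearMap.adjoint T * T) (v i)) (v j) = 0
    rw [hsymm.apply_eigenvectorBasis hfin i, inner_smul_left]
    change _ * inner ℝ (v i) (v j) = 0
    rw [v.orthonormal.2 hij, mul_zero]
  have hon : Orthonormal ℝ
      ({i | T (v i) ≠ 0}.domRestrict fun i => ‖T (v i)‖⁻¹ • T (v i)) := by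
    refine ⟨fun i => ?_, fun i j hij => ?_⟩
    · have : ‖T (v i)‖ ≠ 0 := norm_ne_zero_iff.2 i.2
      change ‖‖T (v i)‖⁻¹ • T (v i)‖ = 1
      rw [norm_smul, norm_inv, norm_norm, inv_mul_cancel₀ this]
    · change inner ℝ (‖T (v i)‖⁻¹ • T (v i)) (‖T (v j)‖⁻¹ • T (v j)) = 0
      simp [inner_smul_left, inner_smul_right, horth i j (fun h => hij (Subtype.ext h))]
  obtain ⟨u, hu⟩ := hon.exists_orthonormalBasis_extension_of_card_eq (by simp)
  refine ⟨u, v, fun i => ?_⟩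
  by_cases h : T (v i) = 0
  · simp [h]
  · rw [hu i h, smul_smul, mul_inv_cancel₀ (norm_ne_zero_iff.2 h), one_smul]

/-- Singular value decomposition of a matrix of operator norm at most one. -/
lemma exists_eq_mul_diagonal_mul {n : ℕ} (A : Mat n) (hA : matOpNorm A ≤ 1) :
    ∃ U ∈ Oset n, ∃ V ∈ Oset n, ∃ d : Fin n → ℝ, (∀ i, |d i| ≤ 1) ∧
      A = U * diagonal d * V := by
  obtain ⟨u, v, huv⟩ := exists_orthonormalBasis_map_eq_norm_smul (matCLM A : Euc n →ₗ[ℝ] Euc n)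
  have hO (b : OrthonormalBasis (Fin n) ℝ (Euc n)) :
      (of fun j i => b i j : Mat n) ∈ Oset n := by
    ext i j
    have h := orthonormal_iff_ite.1 b.orthonormal j i
    simp only [PiLp.inner_apply, RCLike.inner_apply, conj_trivial] at h
    simp [mul_apply, one_apply, h, eq_comm]
  refine ⟨_, hO u, (of fun j i => v i j : Mat n)ᵀ, ?_, fun i => ‖matCLM A (v i)‖, ?_, ?_⟩
  · exact mul_eq_one_comm.1 (hO v)
  · intro i
    rw [abs_norm]
    simpa using (matCLM A).le_of_opNorm_le hA (v i)
  · have hcol : A * (of fun j i => v i j : Mat n) =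
        (of fun j i => u i j : Mat n) * diagonal fun i => ‖matCLM A (v i)‖ := by
      ext j i
      have h := congrArg (fun x : Euc n => x j) (huv i)
      simp only [ContinuousLinearMap.coe_coe, PiLp.smul_apply, smul_eq_mul, matCLM_apply] at h
      rw [mul_diagonal, mul_apply]
      simpa [mul_comm] using h
    rw [← hcol, Matrix.mul_assoc, mul_eq_one_comm.1 (hO v), Matrix.mul_one]

lemma rank_mul_of_mem_Oset {n : ℕ} {U V : Mat n} (hU : U ∈ Oset n) (hV : V ∈ Oset n) (M : Mat n) :
    (U * M * V).rank = M.rank := by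
  have hU' : IsUnit U.det := isUnit_det_of_left_inverse hU
  have hV' : IsUnit V.det := isUnit_det_of_left_inverse hV
  rw [rank_mul_eq_left_of_isUnit_det _ _ hV', rank_mul_eq_right_of_isUnit_det _ _ hU']

lemma mul_diagonal_mul_mem_lamSets {n : ℕ} {U V : Mat n} (hU : U ∈ Oset n) (hV : V ∈ Oset n)
    (k : ℕ) (d : Fin n → ℝ) (hd : ∀ i, |d i| ≤ 1)
    (hk : (Finset.univ.filter fun i => |d i| ≠ 1).card ≤ k) :
    U * diagonal d * V ∈ lamSets (Oset n) k := by
  induction k generalizing d with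
  | zero =>
    have hd1 : ∀ i, d i * d i = 1 := by
      intro i
      have h : |d i| = 1 := by
        by_contra h
        have : i ∈ Finset.univ.filter fun i => |d i| ≠ 1 := by simp [h]
        rw [Finset.card_eq_zero.1 (Nat.le_zero.1 hk)] at this
        simp at this
      rw [← abs_mul_abs_self, h, one_mul]
    change (U * diagonal d * V)ᵀ * (U * diagonal d * V) = 1
    have hU' : Uᵀ * U = 1 := hU
    have hV' : Vᵀ * V = 1 := hV
    calc (U * diagonal d * V)ᵀ * (U * diagonal d * V)
        = Vᵀ * (diagonal d * (Uᵀ * U) * diagonal d) * V := by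
          simp only [transpose_mul, diagonal_transpose, Matrix.mul_assoc]
      _ = 1 := by
          rw [hU', Matrix.mul_one, diagonal_mul_diagonal]
          simp [hd1, hV']
  | succ k ih =>
    by_cases hall : ∀ i, |d i| = 1
    · exact Or.inl (ih d hd (by simp [hall]))
    push Not at hall
    obtain ⟨i, hi⟩ := hall
    have hlt : |d i| < 1 := lt_of_le_of_ne (hd i) hi
    obtain ⟨h1, h2⟩ := abs_lt.1 hlt
    have hmem (c : ℝ) (hc : |c| = 1) :
        U * diagonal (Function.update d i c) * V ∈ lamSets (Oset n) k := by
      refine ih _ (fun j => ?_) ?_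
      · rcases eq_or_ne j i with rfl | hj
        · simp [hc]
        · simpa [hj] using hd j
      · refine Nat.le_of_lt_succ (lt_of_lt_of_le (Finset.card_lt_card ?_) hk)
        refine (Finset.ssubset_iff_of_subset fun j => ?_).2 ⟨i, by simp [hi], by simp [hc]⟩
        rcases eq_or_ne j i with rfl | hj
        · simp [hc]
        · simp [hj]
    refine Or.inr ⟨_, hmem 1 (by simp), _, hmem (-1) (by simp), (1 + d i) / 2,
      ⟨by linarith, by linarith⟩, ?_, ?_⟩
    · rw [← Matrix.sub_mul, ← Matrix.mul_sub, rank_mul_of_mem_Oset hU hV, diagonal_sub,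
        rank_diagonal, Fintype.card_eq_one_iff]
      refine ⟨⟨i, by norm_num⟩, fun ⟨j, hj⟩ => Subtype.ext ?_⟩
      by_contra h
      simp [show j ≠ i from h] at hj
    · rw [← Matrix.smul_mul, ← Matrix.mul_smul, ← Matrix.smul_mul, ← Matrix.mul_smul,
        ← Matrix.add_mul, ← Matrix.mul_add, ← diagonal_smul, ← diagonal_smul, diagonal_add]
      congr 3
      ext j
      rcases eq_or_ne j i with rfl | hj
      · simp; ring
      · simp [hj]; ring

lemma matOpNorm_le_one_subset_lamSets (n : ℕ) :
    {A : Mat n | matOpNorm A ≤ 1} ⊆ lamSets (Oset n) n := by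
  intro A hA
  obtain ⟨U, hU, V, hV, d, hd, rfl⟩ := exists_eq_mul_diagonal_mul A hA
  exact mul_diagonal_mul_mem_lamSets hU hV n d hd ((Finset.card_le_univ _).trans (by simp))

lemma interior_matOpNorm_le_one (n : ℕ) :
    interior {A : Mat n | matOpNorm A ≤ 1} = {A : Mat n | matOpNorm A < 1} := by
  refine Subset.antisymm (fun A hA => ?_) (interior_maximal (fun A (hA : matOpNorm A < 1) => hA.le)
    (isOpen_lt continuous_matOpNorm continuous_const))
  have hcont : ContinuousAt (fun t : ℝ => t • A) 1 := by fun_prop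
  have hev := hcont.preimage_mem_nhds (by rw [one_smul]; exact mem_interior_iff_mem_nhds.1 hA)
  obtain ⟨t, ht, ht1⟩ := ((Filter.Eventually.filter_mono nhdsWithin_le_nhds hev).and
    (self_mem_nhdsWithin : Ioi (1 : ℝ) ∈ nhdsWithin 1 (Ioi 1))).exists
  have h1 : (1 : ℝ) < t := ht1
  have h2 : matOpNorm (t • A) ≤ 1 := ht
  rw [matOpNorm_smul, abs_of_pos (by linarith)] at h2
  by_contra h
  have h3 : 1 ≤ matOpNorm A := not_lt.1 h
  nlinarith

/-- For every `n ≥ 2`: `conv(O(n)) = O(n)^{lc} = {σ_n(A) ≤ 1} = R_n(O(n))`, and the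
interior of `conv(O(n))` is `{σ_n(A) < 1}`. -/
theorem hulls_of_On (n : ℕ) (hn : 2 ≤ n) :
    convexHull ℝ (Oset n) = lamHull (Oset n) ∧
    lamHull (Oset n) = {A : Mat n | matOpNorm A ≤ 1} ∧
    {A : Mat n | matOpNorm A ≤ 1} = lamSets (Oset n) n ∧
    interior (convexHull ℝ (Oset n)) = {A : Mat n | matOpNorm A < 1} := by
  have hcs : convexHull ℝ (Oset n) ⊆ {A : Mat n | matOpNorm A ≤ 1} :=
    convexHull_min (Oset_subset_matOpNorm_le_one n) (convex_matOpNorm_le_one n)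
  have hsr := matOpNorm_le_one_subset_lamSets n
  have hrl : lamSets (Oset n) n ⊆ lamHull (Oset n) := subset_iUnion _ n
  have hlc : lamHull (Oset n) ⊆ convexHull ℝ (Oset n) :=
    iUnion_subset fun l => lamSets_subset_convexHull _ l
  refine ⟨(hcs.trans (hsr.trans hrl)).antisymm hlc, (hlc.trans hcs).antisymm (hsr.trans hrl),
    hsr.antisymm (hrl.trans (hlc.trans hcs)), ?_⟩
  rw [hcs.antisymm (hsr.trans (hrl.trans hlc)), interior_matOpNorm_le_one]
end
end

section
/- Let A,B ∈ ℝ^{2×2} with A − B = a ⊗ n for some a ∈ ℝ² ∖ {0} and unit vector n ∈ S¹, let λ ∈ (0,1) and C = (1−λ)A + λB. Then for each δ ∈ (0,1/2), setting ε = 4√2·δ·λ(1−λ)|a|, there exist a diamond Ω_δ ⊂ ℝ² of aspect ratio 1:δ and a piecewise affine Lipschitz map u : Ω_δ → ℝ² such that: u(x) = Cx on ∂Ω_δ; dist(∇u(x), {A,B}) ≤ ε and |u(x) − Cx| ≤ ε for a.e. x ∈ Ω_δ; and there exist a set Ω' ⊂ Ω_δ which is a union of level sets of ∇u and constants v_A,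 v_B ∈ (1/2,2) with dist(∇u, A) ≤ ε on Ω', |Ω'| = (1−λ)v_A|Ω_δ|, dist(∇u, B) ≤ ε on Ω_δ ∖ Ω', and |Ω_δ ∖ Ω'| = λv_B|Ω_δ|. -/
noncomputable section
open MeasureTheory Set ENNReal Matrix

/-- The Frobenius norm of a matrix. -/
def frobNorm {n : ℕ} (A : Mat n) : ℝ := Real.sqrt (∑ i, ∑ j, (A i j) ^ 2)

/-- A matrix applied to a vector in Euclidean space. -/
def matVec {n : ℕ} (A : Mat n) (x : Euc n) : Euc n := matCLM A x

/-- The vertices `±e₁, ±δe₂ (, ±e₃)` of the model diamond. -/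
def diamondVertices (n : ℕ) (δ : ℝ) : Set (Euc n) :=
  {v | ∃ i : Fin n, v = (if (i : ℕ) = 1 then δ else 1) • EuclideanSpace.single i (1 : ℝ) ∨
       v = -((if (i : ℕ) = 1 then δ else 1) • EuclideanSpace.single i (1 : ℝ))}

/-- The model diamond `conv{±e₁, ±δe₂ (, ±e₃)}`. -/
def baseDiamond (n : ℕ) (δ : ℝ) : Set (Euc n) := convexHull ℝ (diamondVertices n δ)

/-- A diamond of aspect ratio `1:δ` (resp. `1:δ:1`): a translated, rescaled and
rotated copy of the model diamond. -/
def IsDiamond (n : ℕ) (δ : ℝ) (Ω : Set (Euc n)) : Prop :=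
  ∃ (x₀ : Euc n) (r : ℝ) (Q : Mat n), 0 < r ∧ Qᵀ * Q = 1 ∧ Q.det = 1 ∧
    Ω = (fun y => x₀ + r • matVec Q y) '' baseDiamond n δ

/-- A continuous map which is affine on each polytope of a finite cover of `Ω`. -/
def IsPiecewiseAffine {n : ℕ} (Ω : Set (Euc n)) (u : Euc n → Euc n) : Prop :=
  ContinuousOn u Ω ∧ ∃ (N : ℕ) (P : Fin N → Set (Euc n)),
    (∀ i, ∃ S : Finset (Euc n), P i = convexHull ℝ (S : Set (Euc n))) ∧
    Ω ⊆ ⋃ i, P i ∧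
    (∀ i, ∃ (f : Euc n →ₗ[ℝ] Euc n) (b : Euc n), ∀ x ∈ P i ∩ Ω, u x = f x + b)

/-- The clockwise rotation by a right angle of a planar vector. -/
def perp (n : Euc 2) : Euc 2 := WithLp.toLp 2 ![n 1, -n 0]

lemma inner_eq_coord (v x : Euc 2) : inner ℝ v x = v 0 * x 0 + v 1 * x 1 := by
  simp [PiLp.inner_apply, Fin.sum_univ_two, mul_comm]

@[simp] lemma perp_apply_zero (n : Euc 2) : perp n 0 = n 1 := rfl

@[simp] lemma perp_apply_one (n : Euc 2) : perp n 1 = -n 0 := rfl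

lemma sq_add_sq_of_norm_eq_one {n : Euc 2} (hn : ‖n‖ = 1) : n 0 ^ 2 + n 1 ^ 2 = 1 := by
  have h := EuclideanSpace.norm_sq_eq n
  simpa [hn, Fin.sum_univ_two] using h.symm

lemma inner_perp_self (n : Euc 2) : inner ℝ (perp n) n = 0 := by
  rw [inner_eq_coord]; simp; ring

lemma inner_self_perp (n : Euc 2) : inner ℝ n (perp n) = 0 := by
  rw [inner_eq_coord]; simp; ring

lemma inner_perp_perp {n : Euc 2} (hn : ‖n‖ = 1) : inner ℝ (perp n) (perp n) = 1 := by
  have := sq_add_sq_of_norm_eq_one hn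
  rw [inner_eq_coord]; simp; linarith

lemma norm_perp {n : Euc 2} (hn : ‖n‖ = 1) : ‖perp n‖ = 1 := by
  have h := inner_perp_perp hn
  rw [real_inner_self_eq_norm_sq] at h
  exact (pow_eq_one_iff_of_nonneg (norm_nonneg _) two_ne_zero).1 h

lemma inner_self_of_norm_eq_one {n : Euc 2} (hn : ‖n‖ = 1) : inner ℝ n n = 1 := by
  rw [real_inner_self_eq_norm_sq, hn, one_pow]

lemma eq_perp_add {n : Euc 2} (hn : ‖n‖ = 1) (x : Euc 2) :
    x = inner ℝ (perp n) x • perp n + inner ℝ n x • n := by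
  have h := sq_add_sq_of_norm_eq_one hn
  ext i
  fin_cases i
  · simp [inner_eq_coord]; linear_combination (-x 0) * h
  · simp [inner_eq_coord]; linear_combination (-x 1) * h

lemma matVec_apply (M : Mat 2) (x : Euc 2) (i : Fin 2) :
    matVec M x i = M i 0 * x 0 + M i 1 * x 1 := by
  fin_cases i <;> simp [matVec, matCLM, Matrix.toLpLin_apply]

/-- The closed rhombus with half-diagonals `1` along `perp n` and `k` along `n`. -/
def rhombus (n : Euc 2) (k : ℝ) : Set (Euc 2) :=
  {x | |inner ℝ n x| ≤ k * (1 - |inner ℝ (perp n) x|)}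

lemma mem_rhombus {n x : Euc 2} {k : ℝ} :
    x ∈ rhombus n k ↔ |inner ℝ n x| ≤ k * (1 - |inner ℝ (perp n) x|) := Iff.rfl

lemma convex_rhombus (n : Euc 2) {k : ℝ} (hk : 0 ≤ k) : Convex ℝ (rhombus n k) := by
  intro x hx y hy a b ha hb hab
  simp only [rhombus, mem_ofPred_eq, inner_add_right, inner_smul_right] at *
  have h1 := abs_add_le (a * inner ℝ n x) (b * inner ℝ n y)
  have h2 := mul_le_mul_of_nonneg_left
    (abs_add_le (a * inner ℝ (perp n) x) (b * inner ℝ (perp n) y)) hk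
  simp only [abs_mul, abs_of_nonneg ha, abs_of_nonneg hb] at h1 h2
  have h3 := mul_le_mul_of_nonneg_left hx ha
  have h4 := mul_le_mul_of_nonneg_left hy hb
  have h5 : k * (a + b) = k := by rw [hab, mul_one]
  linarith

lemma mem_convexHull_triangle {n : Euc 2} (hn : ‖n‖ = 1) {σ τ p q : ℝ} (hσ : σ ^ 2 = 1)
    (hτ : τ ^ 2 = 1) (hpq : p < q) {x : Euc 2} (h0 : 0 ≤ σ * inner ℝ (perp n) x)
    (hp : p * (1 - σ * inner ℝ (perp n) x) ≤ τ * inner ℝ n x)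
    (hq : τ * inner ℝ n x ≤ q * (1 - σ * inner ℝ (perp n) x)) :
    x ∈ convexHull ℝ ({σ • perp n, (τ * p) • n, (τ * q) • n} : Set (Euc 2)) := by
  have hd : 0 < q - p := sub_pos.2 hpq
  have hx := eq_perp_add hn x
  set s := inner ℝ (perp n) x
  set t := inner ℝ n x
  set α := (q * (1 - σ * s) - τ * t) / (q - p) with hα
  set β := (τ * t - p * (1 - σ * s)) / (q - p) with hβ
  have hsum : σ * s + α + β = 1 := by rw [hα, hβ]; field_simp; ring
  have hval : α * p + β * q = τ * t := by rw [hα, hβ]; field_simp; ring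
  have key : (σ * s) • (σ • perp n) + α • ((τ * p) • n) + β • ((τ * q) • n) = x := by
    rw [hx, smul_smul, smul_smul, smul_smul, add_assoc, ← add_smul]
    congr 2
    · linear_combination s * hσ
    · linear_combination τ * hval + t * hτ
  have hmem := (convex_convexHull ℝ ({σ • perp n, (τ * p) • n, (τ * q) • n} : Set (Euc 2))).sum_mem
    (t := Finset.univ) (w := ![σ * s, α, β]) (z := ![σ • perp n, (τ * p) • n, (τ * q) • n])
    (by
      intro i _
      fin_cases i
      · exact h0
      · exact div_nonneg (by linarith) hd.le
      · exact div_nonneg (by linarith) hd.le)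
    (by simpa [Fin.sum_univ_three] using hsum)
    (by intro i _; apply subset_convexHull; fin_cases i <;> simp)
  rw [← key]
  simpa [Fin.sum_univ_three] using hmem

lemma triangle_bounds {n : Euc 2} (hn : ‖n‖ = 1) {σ τ p q : ℝ} (hσ : σ ^ 2 = 1)
    (hτ : τ ^ 2 = 1) (hpq : p < q) {x : Euc 2}
    (hx : x ∈ convexHull ℝ ({σ • perp n, (τ * p) • n, (τ * q) • n} : Set (Euc 2))) :
    0 ≤ σ * inner ℝ (perp n) x ∧ p * (1 - σ * inner ℝ (perp n) x) ≤ τ * inner ℝ n x := by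
  have hc : Convex ℝ {x : Euc 2 | 0 ≤ σ * inner ℝ (perp n) x ∧
      p * (1 - σ * inner ℝ (perp n) x) ≤ τ * inner ℝ n x} := by
    rintro x ⟨hx1, hx2⟩ y ⟨hy1, hy2⟩ a b ha hb hab
    simp only [mem_ofPred_eq, inner_add_right, inner_smul_right]
    obtain rfl : b = 1 - a := by linarith
    have h1 := mul_nonneg ha hx1
    have h2 := mul_nonneg hb hy1
    have h3 := mul_le_mul_of_nonneg_left hx2 ha
    have h4 := mul_le_mul_of_nonneg_left hy2 hb
    constructor <;> linarith
  refine convexHull_min ?_ hc hx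
  have hσ' : σ * σ = 1 := by rw [← sq, hσ]
  have hτ' (r : ℝ) : τ * (τ * r) = r := by rw [← mul_assoc, ← sq, hτ, one_mul]
  rintro y (rfl | rfl | rfl) <;>
    simp [inner_smul_right, norm_perp hn, inner_self_perp, inner_perp_self,
      hn, hσ', hτ', hpq.le]

lemma convexHull_vertices {n : Euc 2} (hn : ‖n‖ = 1) {k : ℝ} (hk : 0 < k) :
    convexHull ℝ ({perp n, -perp n, k • n, -(k • n)} : Set (Euc 2)) = rhombus n k := by
  refine Subset.antisymm (convexHull_min ?_ (convex_rhombus n hk.le)) fun x hx => ?_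
  · rintro y (rfl | rfl | rfl | rfl) <;>
      simp [rhombus, inner_smul_right, norm_perp hn, inner_self_perp, inner_perp_self,
        hn, abs_of_pos hk]
  · simp only [rhombus, mem_ofPred_eq] at hx
    have hx' := abs_le.1 hx
    rcases le_total 0 (inner ℝ (perp n) x) with h | h
    · rw [abs_of_nonneg h] at hx'
      refine convexHull_mono ?_ (mem_convexHull_triangle hn (σ := 1) (τ := 1) (p := -k) (q := k)
        (by norm_num) (by norm_num) (by linarith) (by linarith) (by linarith) (by linarith))
      rintro y (rfl | rfl | rfl) <;> simp
    · rw [abs_of_nonpos h] at hx'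
      refine convexHull_mono ?_ (mem_convexHull_triangle hn (σ := -1) (τ := 1) (p := -k) (q := k)
        (by norm_num) (by norm_num) (by linarith) (by linarith) (by linarith) (by linarith))
      rintro y (rfl | rfl | rfl) <;> simp

lemma isDiamond_rhombus {n : Euc 2} (hn : ‖n‖ = 1) {δ : ℝ} (hδ : 0 < δ) :
    IsDiamond 2 δ (rhombus n δ) := by
  have h := sq_add_sq_of_norm_eq_one hn
  refine ⟨0, 1, !![n 1, n 0; -n 0, n 1], one_pos, ?_, ?_, ?_⟩
  · ext i j
    fin_cases i <;> fin_cases j <;> simp [Matrix.mul_apply, Fin.sum_univ_two] <;> linarith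
  · rw [Matrix.det_fin_two_of]; linarith
  · rw [← convexHull_vertices hn hδ]
    have : (fun y : Euc 2 => (0 : Euc 2) + (1 : ℝ) • matVec !![n 1, n 0; -n 0, n 1] y) =
        (matCLM !![n 1, n 0; -n 0, n 1]).toLinearMap := by
      ext y; simp [matVec]
    rw [this, baseDiamond, LinearMap.image_convexHull]
    congr 1
    have e0 : matCLM !![n 1, n 0; -n 0, n 1] (EuclideanSpace.single 0 1) = perp n := by
      ext i; change matVec _ _ i = _
      fin_cases i <;> simp [matVec_apply]
    have e1 : matCLM !![n 1, n 0; -n 0, n 1] (EuclideanSpace.single 1 1) = n := by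
      ext i; change matVec _ _ i = _
      fin_cases i <;> simp [matVec_apply]
    ext y
    constructor
    · rintro (rfl | rfl | rfl | rfl)
      · exact ⟨EuclideanSpace.single 0 1, ⟨0, by simp⟩, e0⟩
      · exact ⟨-EuclideanSpace.single 0 1, ⟨0, by simp⟩, by simp [e0]⟩
      · exact ⟨δ • EuclideanSpace.single 1 1, ⟨1, by simp⟩, by
          simp only [ContinuousLinearMap.coe_coe, map_smul, e1]⟩
      · exact ⟨-(δ • EuclideanSpace.single 1 1), ⟨1, by simp⟩, by
          simp only [ContinuousLinearMap.coe_coe, map_neg, map_smul, e1]⟩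
    · rintro ⟨v, ⟨i, hi⟩, rfl⟩
      fin_cases i <;> rcases hi with rfl | rfl <;>
        simp only [ContinuousLinearMap.coe_coe, map_neg, map_smul, e0, e1, Fin.zero_eta,
          Fin.mk_one] <;> simp

lemma isClosed_rhombus (n : Euc 2) (k : ℝ) : IsClosed (rhombus n k) :=
  isClosed_le (by fun_prop) (by fun_prop)

lemma volume_rhombus_ne_top {n : Euc 2} (hn : ‖n‖ = 1) {k : ℝ} (hk : 0 < k) :
    volume (rhombus n k) ≠ ∞ := by
  rw [← convexHull_vertices hn hk]
  have hf : ({perp n, -perp n, k • n, -(k • n)} : Set (Euc 2)).Finite := Set.toFinite _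
  exact (hf.isCompact_convexHull ℝ).measure_lt_top.ne

lemma volume_rhombus_mul {n : Euc 2} (hn : ‖n‖ = 1) (k : ℝ) {c : ℝ} (hc : 0 < c) :
    volume (rhombus n (c * k)) = ENNReal.ofReal c * volume (rhombus n k) := by
  have h := sq_add_sq_of_norm_eq_one hn
  set M : Mat 2 := 1 + (c⁻¹ - 1) • Matrix.vecMulVec (fun i => n i) (fun j => n j) with hM
  have hdet : LinearMap.det (Matrix.toEuclideanLin M) = c⁻¹ := by
    rw [Matrix.toEuclideanLin, Matrix.toLpLin_eq_toLin, LinearMap.det_toLin, Matrix.det_fin_two]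
    simp [hM, Matrix.vecMulVec_apply]
    linear_combination (c⁻¹ - 1) * h
  have hmap (x : Euc 2) : Matrix.toEuclideanLin M x = x + ((c⁻¹ - 1) * inner ℝ n x) • n := by
    ext i; change matVec M x i = _
    fin_cases i <;> simp [matVec_apply, hM, Matrix.vecMulVec_apply, inner_eq_coord] <;> ring
  have hpre : Matrix.toEuclideanLin M ⁻¹' rhombus n k = rhombus n (c * k) := by
    ext x
    have h1 : inner ℝ n x + (c⁻¹ - 1) * inner ℝ n x = c⁻¹ * inner ℝ n x := by ring
    simp only [rhombus, mem_preimage, mem_ofPred_eq, hmap, inner_add_right, inner_smul_right,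
      inner_perp_self, inner_self_of_norm_eq_one hn, mul_zero, add_zero, mul_one, h1, abs_mul,
      abs_of_pos (inv_pos.2 hc)]
    rw [inv_mul_le_iff₀ hc, mul_assoc]
  rw [← hpre, Measure.addHaar_preimage_linearMap _ (by rw [hdet]; positivity), hdet, inv_inv,
    abs_of_pos hc]

lemma ae_inner_ne {v : Euc 2} (hv : v ≠ 0) (d : ℝ) : ∀ᵐ x : Euc 2, inner ℝ v x ≠ d := by
  have hv2 : inner ℝ v v ≠ 0 := inner_self_ne_zero.2 hv
  have hker : volume ((LinearMap.ker (innerSL ℝ v).toLinearMap : Submodule ℝ (Euc 2)) :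
      Set (Euc 2)) = 0 := by
    refine Measure.addHaar_submodule _ _ fun h => hv2 ?_
    have : v ∈ LinearMap.ker (innerSL ℝ v).toLinearMap := h ▸ Submodule.mem_top
    simpa using this
  rw [← measure_preimage_add_right volume (-((d / inner ℝ v v) • v))] at hker
  rw [ae_iff]
  refine measure_mono_null (fun x hx => ?_) hker
  have hx' : inner ℝ v x = d := by simpa using hx
  change inner ℝ v (x + -((d / inner ℝ v v) • v)) = 0
  rw [inner_add_right, inner_neg_right, inner_smul_right, hx', div_mul_cancel₀ _ hv2]
  ring

/-- The scalar perturbation: on vertical sections it has slope `lam` outside the rhombus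
of half-height `lam * δ` and slope `-(1 - lam)` inside. -/
def profile (n : Euc 2) (δ lam : ℝ) (x : Euc 2) : ℝ :=
  lam * inner ℝ n x - max (-(lam * (δ * (1 - |inner ℝ (perp n) x|))))
    (min (lam * (δ * (1 - |inner ℝ (perp n) x|))) (inner ℝ n x))

open Classical in
/-- The gradient of `profile`. -/
def profileGrad (n : Euc 2) (δ lam : ℝ) (x : Euc 2) : Euc 2 :=
  if x ∈ rhombus n (lam * δ) then (lam - 1) • n
  else lam • n +
    (Real.sign (inner ℝ n x) * Real.sign (inner ℝ (perp n) x) * (lam * δ)) • perp n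

lemma lipschitz_profile (n : Euc 2) (δ lam : ℝ) : ∃ K, LipschitzWith K (profile n δ lam) := by
  have hi (v : Euc 2) : LipschitzWith _ fun x : Euc 2 => inner ℝ v x := (innerSL ℝ v).lipschitz
  have habs : LipschitzWith 1 fun r : ℝ => |r| := lipschitzWith_one_norm (E := ℝ)
  have hw : LipschitzWith _ fun x : Euc 2 => lam * (δ * (1 - |inner ℝ (perp n) x|)) :=
    (lipschitzWith_smul lam).comp ((lipschitzWith_smul δ).comp
      ((LipschitzWith.const (1 : ℝ)).sub (habs.comp (hi (perp n)))))
  exact ⟨_, ((lipschitzWith_smul lam).comp (hi n)).sub (hw.neg.max (hw.min (hi n)))⟩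

lemma profile_of_mem {n : Euc 2} {δ lam : ℝ} {x : Euc 2} (hx : x ∈ rhombus n (lam * δ)) :
    profile n δ lam x = inner ℝ ((lam - 1) • n) x + 0 := by
  have h := abs_le.1 (mem_rhombus.1 hx)
  rw [profile, min_eq_right (by linarith), max_eq_right (by linarith), inner_smul_left]
  simp; ring

lemma profile_of_le {n : Euc 2} {δ lam σ τ : ℝ} {x : Euc 2} (hτ : τ = 1 ∨ τ = -1)
    (h0 : 0 ≤ lam * δ * (1 - σ * inner ℝ (perp n) x))
    (hs : |inner ℝ (perp n) x| = σ * inner ℝ (perp n) x)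
    (hx : lam * δ * (1 - σ * inner ℝ (perp n) x) ≤ τ * inner ℝ n x) :
    profile n δ lam x =
      inner ℝ (lam • n + (τ * σ * (lam * δ)) • perp n) x + -(τ * (lam * δ)) := by
  rw [profile, hs, inner_add_left, inner_smul_left, inner_smul_left]
  rcases hτ with rfl | rfl
  · rw [min_eq_left (by linarith), max_eq_right (by linarith)]
    simp; ring
  · rw [min_eq_right (by linarith), max_eq_left (by linarith)]
    simp; ring

lemma abs_profile_le {n : Euc 2} {δ lam : ℝ} (hδ : 0 < δ) (h0 : 0 < lam) (h1 : lam < 1)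
    {x : Euc 2} (hx : x ∈ rhombus n δ) : |profile n δ lam x| ≤ δ * lam * (1 - lam) := by
  have ht := abs_le.1 (show |inner ℝ n x| ≤ δ * (1 - |inner ℝ (perp n) x|) from hx)
  set w := δ * (1 - |inner ℝ (perp n) x|) with hw
  have hwδ : w ≤ δ := by
    have := mul_nonneg hδ.le (abs_nonneg (inner ℝ (perp n) x))
    rw [hw]; linarith
  have hw0 : 0 ≤ w := by linarith
  have hb : lam * (1 - lam) * w ≤ δ * lam * (1 - lam) := by
    have := mul_le_mul_of_nonneg_left hwδ (mul_pos h0 (sub_pos.2 h1)).le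
    linarith
  have hlw := mul_nonneg h0.le hw0
  rw [profile, ← hw]
  rw [abs_le]
  rcases le_total (inner ℝ n x) (-(lam * w)) with h | h
  · rw [min_eq_right (by linarith), max_eq_left h]
    constructor <;> nlinarith
  rcases le_total (inner ℝ n x) (lam * w) with h' | h'
  · rw [min_eq_right h', max_eq_right h]
    constructor <;> nlinarith
  · rw [min_eq_left h', max_eq_right (by linarith)]
    constructor <;> nlinarith

lemma profile_eq_zero {n : Euc 2} {δ lam : ℝ} (h0 : 0 < lam) (h1 : lam < 1) {x : Euc 2}
    (hx : |inner ℝ n x| = δ * (1 - |inner ℝ (perp n) x|)) : profile n δ lam x = 0 := by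
  have ha := abs_nonneg (inner ℝ n x)
  have hl : lam * |inner ℝ n x| ≤ |inner ℝ n x| := mul_le_of_le_one_left ha h1.le
  have hl0 := mul_nonneg h0.le ha
  rw [profile, ← hx]
  rcases abs_cases (inner ℝ n x) with ⟨h, _⟩ | ⟨h, _⟩ <;> rw [h] at hl hl0 ⊢
  · rw [min_eq_left hl, max_eq_right (by linarith)]; ring
  · rw [min_eq_right (by linarith), max_eq_left (by linarith)]; ring

lemma hasFDerivAt_of_eventuallyEq_inner {f : Euc 2 → ℝ} {w x : Euc 2} {d : ℝ}
    (h : ∀ᶠ y in nhds x, f y = inner ℝ w y + d) : HasFDerivAt f (innerSL ℝ w) x :=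
  (((innerSL ℝ w).hasFDerivAt (x := x)).add_const d).congr_of_eventuallyEq h

lemma exists_sign {s : ℝ} (hs : s ≠ 0) :
    ∃ σ : ℝ, (σ = 1 ∨ σ = -1) ∧ Real.sign s = σ ∧ 0 < σ * s := by
  rcases hs.lt_or_gt with h | h
  · exact ⟨-1, Or.inr rfl, Real.sign_of_neg h, by linarith⟩
  · exact ⟨1, Or.inl rfl, Real.sign_of_pos h, by linarith⟩

lemma abs_eq_mul_of_nonneg {σ s : ℝ} (hσ : σ = 1 ∨ σ = -1) (h : 0 ≤ σ * s) : |s| = σ * s := by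
  rcases hσ with rfl | rfl
  · rw [abs_of_nonneg (by linarith), one_mul]
  · rw [abs_of_nonpos (by linarith), neg_one_mul]

lemma ae_hasFDerivAt_profile {n : Euc 2} (hn : ‖n‖ = 1) {δ lam : ℝ} (hδ : 0 < δ)
    (h0 : 0 < lam) : ∀ᵐ x, x ∈ rhombus n δ →
      HasFDerivAt (profile n δ lam) (innerSL ℝ (profileGrad n δ lam x)) x := by
  have hv (c : ℝ) : n + c • perp n ≠ 0 := fun h => by
    have := congrArg (inner ℝ n) h
    simp [inner_add_right, inner_smul_right, inner_self_perp, hn] at this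
  have hp : perp n ≠ 0 := norm_ne_zero_iff.1 (by rw [norm_perp hn]; exact one_ne_zero)
  have hk : 0 < lam * δ := mul_pos h0 hδ
  filter_upwards [ae_inner_ne hp 0, ae_inner_ne (hv (lam * δ)) (lam * δ),
    ae_inner_ne (hv (lam * δ)) (-(lam * δ)), ae_inner_ne (hv (-(lam * δ))) (lam * δ),
    ae_inner_ne (hv (-(lam * δ))) (-(lam * δ))] with x hs h1 h2 h3 h4 hx
  simp only [inner_add_left, inner_smul_left, conj_trivial] at h1 h2 h3 h4
  have hne : |inner ℝ n x| ≠ lam * δ * (1 - |inner ℝ (perp n) x|) := by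
    intro h
    rcases abs_cases (inner ℝ n x) with ⟨e, _⟩ | ⟨e, _⟩ <;>
      rcases abs_cases (inner ℝ (perp n) x) with ⟨e', _⟩ | ⟨e', _⟩ <;> rw [e, e'] at h
    · exact h1 (by linarith)
    · exact h3 (by linarith)
    · exact h4 (by linarith)
    · exact h2 (by linarith)
  rcases hne.lt_or_gt with h | h
  · rw [profileGrad, if_pos (mem_rhombus.2 h.le)]
    refine hasFDerivAt_of_eventuallyEq_inner (d := 0) ?_
    have hopen : IsOpen {y : Euc 2 | |inner ℝ n y| < lam * δ * (1 - |inner ℝ (perp n) y|)} :=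
      isOpen_lt (by fun_prop) (by fun_prop)
    filter_upwards [hopen.mem_nhds h] with y hy
    exact profile_of_mem (le_of_lt hy)
  · rw [profileGrad, if_neg (mt mem_rhombus.1 (not_le.2 h))]
    have hw : 0 < 1 - |inner ℝ (perp n) x| := by
      have hx' : |inner ℝ n x| ≤ δ * (1 - |inner ℝ (perp n) x|) := hx
      have h5 := (abs_nonneg (inner ℝ n x)).trans hx'
      rcases (nonneg_of_mul_nonneg_right h5 hδ).eq_or_lt with h6 | h6
      · rw [← h6, mul_zero] at hx' h
        linarith
      · exact h6
    have ht : inner ℝ n x ≠ 0 := by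
      intro ht
      rw [ht, abs_zero] at h
      have := mul_pos hk hw
      linarith
    obtain ⟨σ, hσ, hσs, hσ0⟩ := exists_sign hs
    obtain ⟨τ, hτ, hτt, hτ0⟩ := exists_sign ht
    rw [hσs, hτt]
    refine hasFDerivAt_of_eventuallyEq_inner (d := -(τ * (lam * δ))) ?_
    rw [abs_eq_mul_of_nonneg hσ hσ0.le] at h hw
    rw [abs_eq_mul_of_nonneg hτ hτ0.le] at h
    have o1 : IsOpen {y : Euc 2 | lam * δ * (1 - σ * inner ℝ (perp n) y) < τ * inner ℝ n y} :=
      isOpen_lt (by fun_prop) (by fun_prop)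
    have o2 : IsOpen {y : Euc 2 | 0 < 1 - σ * inner ℝ (perp n) y} :=
      isOpen_lt (by fun_prop) (by fun_prop)
    have o3 : IsOpen {y : Euc 2 | 0 < σ * inner ℝ (perp n) y} :=
      isOpen_lt (by fun_prop) (by fun_prop)
    filter_upwards [o1.mem_nhds h, o2.mem_nhds hw, o3.mem_nhds hσ0] with y y1 y2 y3
    exact profile_of_le hτ (mul_pos hk y2).le (abs_eq_mul_of_nonneg hσ (le_of_lt y3)) (le_of_lt y1)

/-- The linear map `C` perturbed by a scalar function in the direction `a`. -/
def perturb (C : Mat 2) (a : Euc 2) (f : Euc 2 → ℝ) (x : Euc 2) : Euc 2 :=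
  matVec C x + f x • a

lemma matCLM_add_vecMulVec (C : Mat 2) (a w : Euc 2) :
    matCLM (C + Matrix.vecMulVec (fun i => a i) (fun j => w j)) =
      matCLM C + (innerSL ℝ w).smulRight a := by
  ext x i
  change matVec _ x i = matVec C x i + inner ℝ w x * a i
  rw [matVec_apply, matVec_apply, inner_eq_coord]
  simp [Matrix.vecMulVec_apply]; ring

lemma frobNorm_vecMulVec (a w : Euc 2) :
    frobNorm (Matrix.vecMulVec (fun i => a i) (fun j => w j)) = ‖a‖ * ‖w‖ := by
  rw [frobNorm, EuclideanSpace.norm_eq, EuclideanSpace.norm_eq, ← Real.sqrt_mul (by positivity)]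
  congr 1
  simp [Fin.sum_univ_two, Matrix.vecMulVec_apply]; ring

lemma HasFDerivAt.perturb {f : Euc 2 → ℝ} {w x : Euc 2} (h : HasFDerivAt f (innerSL ℝ w) x)
    (C : Mat 2) (a : Euc 2) : HasFDerivAt (perturb C a f)
      (matCLM (C + Matrix.vecMulVec (fun i => a i) (fun j => w j))) x := by
  rw [matCLM_add_vecMulVec]
  exact (matCLM C).hasFDerivAt.add (h.smul_const a)

lemma LipschitzWith.perturb {f : Euc 2 → ℝ} {K : NNReal} (h : LipschitzWith K f)
    (C : Mat 2) (a : Euc 2) : ∃ L, LipschitzWith L (perturb C a f) :=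
  ⟨_, (matCLM C).lipschitz.add (((1 : ℝ →L[ℝ] ℝ).smulRight a).lipschitz.comp h)⟩

lemma perturb_eq_affine {f : Euc 2 → ℝ} {w : Euc 2} {d : ℝ} (C : Mat 2) (a : Euc 2)
    {s : Set (Euc 2)} (h : ∀ x ∈ s, f x = inner ℝ w x + d) :
    ∃ (F : Euc 2 →ₗ[ℝ] Euc 2) (b : Euc 2), ∀ x ∈ s, perturb C a f x = F x + b := by
  refine ⟨(matCLM C + (innerSL ℝ w).smulRight a).toLinearMap, d • a, fun x hx => ?_⟩
  change matVec C x + f x • a = (matVec C x + inner ℝ w x • a) + d • a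
  rw [h x hx, add_smul, add_assoc]

lemma isPiecewiseAffine_perturb_profile {n : Euc 2} (hn : ‖n‖ = 1) {δ lam : ℝ} (hδ : 0 < δ)
    (h0 : 0 < lam) (h1 : lam < 1) (C : Mat 2) (a : Euc 2) :
    IsPiecewiseAffine (rhombus n δ) (perturb C a (profile n δ lam)) := by
  have hk : 0 < lam * δ := mul_pos h0 hδ
  have hkδ : lam * δ < δ := mul_lt_of_lt_one_left hδ h1
  obtain ⟨K, hK⟩ := lipschitz_profile n δ lam
  obtain ⟨L, hL⟩ := hK.perturb C a
  let T (σ τ : ℝ) : Set (Euc 2) :=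
    convexHull ℝ ({σ • perp n, (τ * (lam * δ)) • n, (τ * δ) • n} : Set (Euc 2))
  have hT (σ τ : ℝ) : ∃ S : Finset (Euc 2), T σ τ = convexHull ℝ (S : Set (Euc 2)) := by
    classical
    exact ⟨{σ • perp n, (τ * (lam * δ)) • n, (τ * δ) • n}, by simp [T]⟩
  have sq_one {σ : ℝ} (hσ : σ = 1 ∨ σ = -1) : σ ^ 2 = 1 := by
    rcases hσ with rfl | rfl <;> norm_num
  have hTu {σ τ : ℝ} (hσ : σ = 1 ∨ σ = -1) (hτ : τ = 1 ∨ τ = -1) :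
      ∃ (F : Euc 2 →ₗ[ℝ] Euc 2) (b : Euc 2), ∀ x ∈ T σ τ ∩ rhombus n δ,
        perturb C a (profile n δ lam) x = F x + b := by
    refine perturb_eq_affine (w := lam • n + (τ * σ * (lam * δ)) • perp n)
      (d := -(τ * (lam * δ))) C a fun x hx => ?_
    obtain ⟨b1, b2⟩ := triangle_bounds hn (sq_one hσ) (sq_one hτ) hkδ hx.1
    have hs := abs_eq_mul_of_nonneg hσ b1
    refine profile_of_le hτ ?_ hs b2
    have h5 := (abs_nonneg (inner ℝ n x)).trans hx.2
    rw [hs] at h5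
    exact mul_nonneg hk.le (nonneg_of_mul_nonneg_right h5 hδ)
  have hcover : ∀ x ∈ rhombus n δ, x ∉ rhombus n (lam * δ) →
      ∃ σ τ : ℝ, (σ = 1 ∨ σ = -1) ∧ (τ = 1 ∨ τ = -1) ∧ x ∈ T σ τ := by
    intro x hx hx'
    have ex (s : ℝ) : ∃ σ : ℝ, (σ = 1 ∨ σ = -1) ∧ 0 ≤ σ * s := by
      rcases le_total 0 s with h | h
      · exact ⟨1, Or.inl rfl, by linarith⟩
      · exact ⟨-1, Or.inr rfl, by linarith⟩
    obtain ⟨σ, hσ, hσs⟩ := ex (inner ℝ (perp n) x)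
    obtain ⟨τ, hτ, hτt⟩ := ex (inner ℝ n x)
    refine ⟨σ, τ, hσ, hτ, ?_⟩
    simp only [rhombus, mem_ofPred_eq, not_le, abs_eq_mul_of_nonneg hσ hσs,
      abs_eq_mul_of_nonneg hτ hτt] at hx hx'
    exact mem_convexHull_triangle hn (sq_one hσ) (sq_one hτ) hkδ hσs hx'.le hx
  refine ⟨hL.continuous.continuousOn, 5,
    ![rhombus n (lam * δ), T 1 1, T 1 (-1), T (-1) 1, T (-1) (-1)], ?_, ?_, ?_⟩
  · intro i
    fin_cases i
    · classical
      refine ⟨{perp n, -perp n, (lam * δ) • n, -((lam * δ) • n)}, ?_⟩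
      simpa using (convexHull_vertices hn hk).symm
    all_goals exact hT _ _
  · intro x hx
    rw [mem_iUnion]
    by_cases hx' : x ∈ rhombus n (lam * δ)
    · exact ⟨0, hx'⟩
    · obtain ⟨σ, τ, rfl | rfl, rfl | rfl, h⟩ := hcover x hx hx'
      exacts [⟨1, h⟩, ⟨2, h⟩, ⟨3, h⟩, ⟨4, h⟩]
  · intro i
    fin_cases i
    · exact perturb_eq_affine C a fun x hx => profile_of_mem hx.1
    · exact hTu (Or.inl rfl) (Or.inl rfl)
    · exact hTu (Or.inl rfl) (Or.inr rfl)
    · exact hTu (Or.inr rfl) (Or.inl rfl)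
    · exact hTu (Or.inr rfl) (Or.inr rfl)

lemma abs_inner_eq_of_mem_frontier {n : Euc 2} {k : ℝ} {x : Euc 2}
    (hx : x ∈ frontier (rhombus n k)) :
    |inner ℝ n x| = k * (1 - |inner ℝ (perp n) x|) :=
  frontier_le_subset_eq (by fun_prop) (by fun_prop) hx

/-- Exact volume fractions, when the phase `B` has volume fraction at most one half. -/
lemma exists_building_block_of_le_half (A B : Mat 2) (a nv : Euc 2)
    (ha : a ≠ 0) (hnv : ‖nv‖ = 1)
    (hAB : A - B = Matrix.vecMulVec (fun i => a i) (fun j => nv j))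
    {lam : ℝ} (h0 : 0 < lam) (h1 : lam ≤ 1 / 2) {δ : ℝ} (hδ : 0 < δ) {ε : ℝ}
    (hε : ε = 4 * Real.sqrt 2 * δ * lam * (1 - lam) * ‖a‖) :
    ∃ (Ωδ : Set (Euc 2)) (u : Euc 2 → Euc 2) (g : Euc 2 → Mat 2) (V : Set (Mat 2)),
      IsDiamond 2 δ Ωδ ∧
      IsPiecewiseAffine Ωδ u ∧ (∃ L : NNReal, LipschitzOnWith L u Ωδ) ∧
      (∀ x ∈ frontier Ωδ, u x = matVec ((1 - lam) • A + lam • B) x) ∧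
      (∀ᵐ x, x ∈ Ωδ → HasFDerivAt u (matCLM (g x)) x) ∧
      (∀ x ∈ Ωδ, ‖u x - matVec ((1 - lam) • A + lam • B) x‖ ≤ ε) ∧
      (∀ x, g x ∈ V → frobNorm (g x - A) ≤ ε) ∧
      (∀ x, g x ∉ V → frobNorm (g x - B) ≤ ε) ∧
      volume {x ∈ Ωδ | g x ∈ V} = ENNReal.ofReal (1 - lam) * volume Ωδ ∧
      volume {x ∈ Ωδ | g x ∉ V} = ENNReal.ofReal lam * volume Ωδ := by
  have hl1 : lam < 1 := by linarith
  set C : Mat 2 := (1 - lam) • A + lam • B with hC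
  have hna := norm_nonneg a
  have hsqrt : 1 ≤ Real.sqrt 2 := Real.one_le_sqrt.2 (by norm_num)
  have hε1 : δ * lam * (1 - lam) * ‖a‖ ≤ ε := by
    have : 0 ≤ δ * lam * (1 - lam) * ‖a‖ := by
      have := sub_pos.2 hl1
      positivity
    rw [hε]; nlinarith
  have hε2 : lam * δ * ‖a‖ ≤ ε := by
    have h2 : 0 ≤ lam * δ * ‖a‖ := by positivity
    have h3 : 1 ≤ 4 * Real.sqrt 2 * (1 - lam) := by nlinarith
    rw [hε]; nlinarith
  have hε0 : 0 ≤ ε := le_trans (by positivity) hε2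
  set g : Euc 2 → Mat 2 := fun x =>
    C + Matrix.vecMulVec (fun i => a i) (fun j => profileGrad nv δ lam x j) with hg
  have hgA (x : Euc 2) : g x - A =
      Matrix.vecMulVec (fun i => a i) (fun j => (profileGrad nv δ lam x - lam • nv) j) := by
    ext i j
    have := congrFun (congrFun hAB i) j
    simp [hg, hC, Matrix.vecMulVec_apply] at this ⊢
    linear_combination -lam * this
  have hgB (x : Euc 2) : g x - B =
      Matrix.vecMulVec (fun i => a i) (fun j => (profileGrad nv δ lam x - (lam - 1) • nv) j) := by
    ext i j
    have := congrFun (congrFun hAB i) j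
    simp [hg, hC, Matrix.vecMulVec_apply] at this ⊢
    linear_combination (1 - lam) * this
  have hmem (x : Euc 2) : g x = B ↔ x ∈ rhombus nv (lam * δ) := by
    constructor
    · intro h
      by_contra hx
      have h2 := frobNorm_vecMulVec a (profileGrad nv δ lam x - (lam - 1) • nv)
      rw [← hgB, h, sub_self] at h2
      have h3 : ‖profileGrad nv δ lam x - (lam - 1) • nv‖ = 0 := by
        have : frobNorm (0 : Mat 2) = 0 := by simp [frobNorm]
        rw [this] at h2
        exact (mul_eq_zero.1 h2.symm).resolve_left (norm_ne_zero_iff.2 ha)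
      have h4 := congrArg (inner ℝ nv) (norm_eq_zero.1 h3)
      rw [profileGrad, if_neg hx] at h4
      simp [inner_sub_right, inner_add_right, inner_smul_right, inner_self_perp, hnv] at h4
    · intro h
      have h2 := hgB x
      rw [profileGrad, if_pos h, sub_self] at h2
      refine sub_eq_zero.1 (h2.trans ?_)
      ext i j
      simp [Matrix.vecMulVec_apply]
  obtain ⟨K, hK⟩ := lipschitz_profile nv δ lam
  obtain ⟨L, hL⟩ := hK.perturb C a
  have hsub : rhombus nv (lam * δ) ⊆ rhombus nv δ := fun x hx => by
    have hx' : |inner ℝ nv x| ≤ lam * δ * (1 - |inner ℝ (perp nv) x|) := hx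
    have h2 := nonneg_of_mul_nonneg_right ((abs_nonneg _).trans hx') (mul_pos h0 hδ)
    exact hx'.trans (mul_le_mul_of_nonneg_right (mul_le_of_le_one_left hδ.le hl1.le) h2)
  have hvol := volume_rhombus_mul hnv δ h0
  refine ⟨rhombus nv δ, perturb C a (profile nv δ lam), g, {B}ᶜ, isDiamond_rhombus hnv hδ,
    isPiecewiseAffine_perturb_profile hnv hδ h0 hl1 C a, ⟨L, hL.lipschitzOnWith⟩, ?_, ?_, ?_, ?_,
    ?_, ?_, ?_⟩
  · intro x hx
    rw [perturb, profile_eq_zero h0 hl1 (abs_inner_eq_of_mem_frontier hx), zero_smul, add_zero]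
  · filter_upwards [ae_hasFDerivAt_profile hnv hδ h0] with x hx hxΩ
    exact (hx hxΩ).perturb C a
  · intro x hx
    rw [perturb, add_sub_cancel_left, norm_smul, Real.norm_eq_abs]
    exact (mul_le_mul_of_nonneg_right (abs_profile_le hδ h0 hl1 hx) hna).trans hε1
  · intro x hx
    have hx' : x ∉ rhombus nv (lam * δ) := fun h => hx ((hmem x).2 h)
    have hsign (r : ℝ) : |Real.sign r| ≤ 1 := by
      rcases Real.sign_apply_eq r with h | h | h <;> simp [h]
    rw [hgA, frobNorm_vecMulVec, profileGrad, if_neg hx', add_sub_cancel_left, norm_smul,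
      norm_perp hnv, mul_one, Real.norm_eq_abs, abs_mul, abs_mul, abs_of_pos (mul_pos h0 hδ)]
    have h2 := mul_le_one₀ (hsign (inner ℝ nv x)) (abs_nonneg _)
      (hsign (inner ℝ (perp nv) x))
    have h3 := mul_le_of_le_one_left (mul_pos h0 hδ).le h2
    calc _ ≤ ‖a‖ * (lam * δ) := mul_le_mul_of_nonneg_left h3 hna
      _ ≤ ε := by linarith
  · intro x hx
    have hx' : g x = B := by simpa using hx
    rw [hx', sub_self]
    simpa [frobNorm] using hε0
  · have hset : {x ∈ rhombus nv δ | g x ∈ ({B}ᶜ : Set (Mat 2))} =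
        rhombus nv δ \ rhombus nv (lam * δ) := by
      ext x; simp [hmem]
    have hfin : volume (rhombus nv (lam * δ)) ≠ ∞ := volume_rhombus_ne_top hnv (mul_pos h0 hδ)
    rw [hset, measure_sdiff hsub (isClosed_rhombus _ _).measurableSet.nullMeasurableSet hfin, hvol,
      ENNReal.ofReal_sub _ h0.le, ENNReal.ofReal_one,
      ENNReal.sub_mul fun _ _ => volume_rhombus_ne_top hnv hδ, one_mul]
  · have hset : {x ∈ rhombus nv δ | g x ∉ ({B}ᶜ : Set (Mat 2))} = rhombus nv (lam * δ) := by
      ext x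
      simp only [mem_compl_iff, mem_singleton_iff, not_not, hmem, mem_ofPred_eq]
      exact ⟨And.right, fun h => ⟨hsub h, h⟩⟩
    rw [hset, hvol]

/-- The 2D replacement construction (building block) without trace constraint:
for rank-one connected `A, B` and `C₀ = (1−λ)A + λB` and any `δ ∈ (0,1/2)` there are
a diamond `Ω_δ` of aspect ratio `1:δ` and a piecewise affine Lipschitz map `u` with
boundary data `C₀x`, gradient `ε`-close to `{A,B}` for `ε = 4√2·δ·λ(1−λ)|a|`, and the
stated volume fractions for the region near `A` (a union of level sets of `∇u`). -/
theorem building_block_2D (A B : Mat 2) (a nv : Euc 2)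
    (ha : a ≠ 0) (hnv : ‖nv‖ = 1)
    (hAB : A - B = Matrix.vecMulVec (fun i => a i) (fun j => nv j))
    (lam : ℝ) (hlam : lam ∈ Set.Ioo (0 : ℝ) 1)
    (C₀ : Mat 2) (hC₀ : C₀ = (1 - lam) • A + lam • B)
    (δ : ℝ) (hδ : δ ∈ Set.Ioo (0 : ℝ) (1/2)) :
    ∃ (Ωδ : Set (Euc 2)) (u : Euc 2 → Euc 2) (g : Euc 2 → Mat 2),
      IsDiamond 2 δ Ωδ ∧
      IsPiecewiseAffine Ωδ u ∧ (∃ L : NNReal, LipschitzOnWith L u Ωδ) ∧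
      (∀ x ∈ frontier Ωδ, u x = matVec C₀ x) ∧
      (∀ᵐ x, x ∈ Ωδ → HasFDerivAt u (matCLM (g x)) x) ∧
      (∀ᵐ x, x ∈ Ωδ →
        min (frobNorm (g x - A)) (frobNorm (g x - B))
            ≤ 4 * Real.sqrt 2 * δ * lam * (1 - lam) * ‖a‖ ∧
        ‖u x - matVec C₀ x‖ ≤ 4 * Real.sqrt 2 * δ * lam * (1 - lam) * ‖a‖) ∧
      ∃ Ω' ⊆ Ωδ, (∃ V : Set (Mat 2), Ω' = {x ∈ Ωδ | g x ∈ V}) ∧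
        ∃ vA ∈ Set.Ioo (1/2 : ℝ) 2, ∃ vB ∈ Set.Ioo (1/2 : ℝ) 2,
          (∀ᵐ x, x ∈ Ω' →
            frobNorm (g x - A) ≤ 4 * Real.sqrt 2 * δ * lam * (1 - lam) * ‖a‖) ∧
          volume Ω' = ENNReal.ofReal ((1 - lam) * vA) * volume Ωδ ∧
          (∀ᵐ x, x ∈ Ωδ \ Ω' →
            frobNorm (g x - B) ≤ 4 * Real.sqrt 2 * δ * lam * (1 - lam) * ‖a‖) ∧
          volume (Ωδ \ Ω') = ENNReal.ofReal (lam * vB) * volume Ωδ := by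
  have h0 := hlam.1
  have h1 := hlam.2
  obtain ⟨Ωδ, u, g, V, hΩ, hpa, hL, hbd, hder, hu, hA, hB, hvA, hvB⟩ :
      ∃ (Ωδ : Set (Euc 2)) (u : Euc 2 → Euc 2) (g : Euc 2 → Mat 2) (V : Set (Mat 2)),
        IsDiamond 2 δ Ωδ ∧
        IsPiecewiseAffine Ωδ u ∧ (∃ L : NNReal, LipschitzOnWith L u Ωδ) ∧
        (∀ x ∈ frontier Ωδ, u x = matVec C₀ x) ∧
        (∀ᵐ x, x ∈ Ωδ → HasFDerivAt u (matCLM (g x)) x) ∧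
        (∀ x ∈ Ωδ, ‖u x - matVec C₀ x‖ ≤ 4 * Real.sqrt 2 * δ * lam * (1 - lam) * ‖a‖) ∧
        (∀ x, g x ∈ V →
          frobNorm (g x - A) ≤ 4 * Real.sqrt 2 * δ * lam * (1 - lam) * ‖a‖) ∧
        (∀ x, g x ∉ V →
          frobNorm (g x - B) ≤ 4 * Real.sqrt 2 * δ * lam * (1 - lam) * ‖a‖) ∧
        volume {x ∈ Ωδ | g x ∈ V} = ENNReal.ofReal (1 - lam) * volume Ωδ ∧
        volume {x ∈ Ωδ | g x ∉ V} = ENNReal.ofReal lam * volume Ωδ := by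
    rcases le_total lam (1 / 2) with h | h
    · rw [hC₀]
      exact exists_building_block_of_le_half A B a nv ha hnv hAB h0 h hδ.1 rfl
    · have hBA : B - A = Matrix.vecMulVec (fun i => (-a) i) (fun j => nv j) := by
        rw [← neg_sub, hAB]
        ext i j
        simp [Matrix.vecMulVec_apply]
      obtain ⟨Ωδ, u, g, V, hΩ, hpa, hL, hbd, hder, hu, hB, hA, hvB, hvA⟩ :=
        exists_building_block_of_le_half B A (-a) nv (neg_ne_zero.2 ha) hnv hBA
          (lam := 1 - lam) (by linarith) (by linarith) hδ.1
          (ε := 4 * Real.sqrt 2 * δ * lam * (1 - lam) * ‖a‖) (by rw [norm_neg]; ring)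
      have hC : (1 - (1 - lam)) • B + (1 - lam) • A = C₀ := by
        rw [hC₀, _root_.sub_sub_cancel, add_comm]
      rw [hC] at hbd hu
      rw [_root_.sub_sub_cancel] at hvB
      refine ⟨Ωδ, u, g, Vᶜ, hΩ, hpa, hL, hbd, hder, hu, hA, fun x hx => hB x ?_, hvA, ?_⟩
      · simpa using hx
      · simpa using hvB
  have hdiff : Ωδ \ {x ∈ Ωδ | g x ∈ V} = {x ∈ Ωδ | g x ∉ V} := by
    ext x
    simp only [mem_sdiff, mem_ofPred_eq]
    tauto
  refine ⟨Ωδ, u, g, hΩ, hpa, hL, hbd, hder, Filter.Eventually.of_forall fun x hx => ⟨?_, hu x hx⟩,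
    {x ∈ Ωδ | g x ∈ V}, fun x hx => hx.1, ⟨V, rfl⟩, 1, by norm_num, 1, by norm_num,
    Filter.Eventually.of_forall fun x hx => hA x hx.2, by rw [mul_one, hvA],
    Filter.Eventually.of_forall fun x hx => hB x fun h => hx.2 ⟨hx.1, h⟩,
    by rw [mul_one, hdiff, hvB]⟩
  by_cases h : g x ∈ V
  · exact (min_le_left _ _).trans (hA x h)
  · exact (min_le_right _ _).trans (hB x h)
end
end
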